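/- arXiv:1509.07400 — 4 statements merged into one kernel-verified Lean document; each statement's English description precedes it below -/
import Mathlib

section
/- Let μ = θ − wθ be a vertex of the polytope Π_θ, and suppose σ_k satisfies l(σ_k w) < l(w). Then for every positive integer b, the lattice point μ + bα_k lies outside Π_θ. Similarly, if u = σ_k w (so l(u) > l(w) is replaced by l(σ_k u) < l(u) with u = σ_k w, i.e., l(w) < l(σ_k w)) and λ = θ − uθ, then for every positive integer b the point λ − bα_k lies outside Π_θ. -/
open scoped BigOperators

noncomputable section

namespace CGMDS

/-- Primitive data: an irreducible reduced root system of rank `r` encoded by its Cartan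
matrix `c` (with a symmetrizing vector `len2` of squared lengths of the simple roots,
normalized so that short roots have length `1`), together with a cover degree `n`,
the norm `p = |p|` of a prime, and Gauss sums `g t = g_t(1,p)`. -/
structure Setup where
  r : ℕ
  hr : 0 < r
  /-- Cartan matrix entries `c i j = ⟨α_i, α_j⟩`. -/
  c : Fin r → Fin r → ℤ
  hcdiag : ∀ i, c i i = 2
  hcoff : ∀ i j, i ≠ j → c i j ≤ 0
  /-- squared lengths `‖α_i‖²` of the simple roots. -/
  len2 : Fin r → ℕ
  hlen2 : ∀ i, 0 < len2 i
  hshort : ∃ i, len2 i = 1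
  /-- symmetry of the inner product: `2(α_i,α_j) = c i j * len2 j`. -/
  hsym : ∀ i j, c i j * len2 j = c j i * len2 i
  /-- positive definiteness of the inner product (finite type). -/
  hposdef : ∀ v : Fin r → ℝ, v ≠ 0 → 0 < ∑ i, ∑ j, v i * v j * ((c i j * (len2 j : ℤ) : ℤ) : ℝ)
  /-- irreducibility (connectedness of the Dynkin diagram). -/
  hconn : ∀ A : Finset (Fin r), A.Nonempty → A ≠ Finset.univ → ∃ i ∈ A, ∃ j, j ∉ A ∧ c i j ≠ 0
  /-- the degree of the metaplectic cover. -/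
  n : ℕ
  hn : 0 < n
  /-- `|p|`, the norm of the prime `p`. -/
  p : ℝ
  hp : 1 < p
  /-- the Gauss sums `g t = g_t(1,p)`. -/
  g : ℤ → ℂ
  hgper : ∀ t : ℤ, g (t + n) = g t
  hgdvd : ∀ t : ℤ, (n : ℤ) ∣ t → g t = -1
  hgmul : ∀ t : ℤ, ¬ (n : ℤ) ∣ t → g t * g (-t) = (p : ℂ)

namespace Setup

variable (S : Setup)

/-- an element of the root lattice `Λ = ℤ^r` (coordinates in the basis of simple roots),
viewed inside `Λ ⊗ ℝ = ℝ^r`. -/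
def coeV (lam : Fin S.r → ℤ) : Fin S.r → ℝ := fun i => (lam i : ℝ)

/-- the simple root `α_k`, as an element of `Λ ⊗ ℝ`. -/
def av (k : Fin S.r) : Fin S.r → ℝ := Pi.single k 1

/-- the simple root `α_k`, as an element of the root lattice. -/
def az (k : Fin S.r) : Fin S.r → ℤ := Pi.single k 1

/-- the height function `d(Σ k_i α_i) = Σ k_i`. -/
def ht (lam : Fin S.r → ℤ) : ℤ := ∑ i, lam i

/-- the `W`-invariant inner product on `Λ ⊗ ℝ`, with `(α_i, α_j) = c i j * len2 j / 2`. -/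
def B (v u : Fin S.r → ℝ) : ℝ := (∑ i, ∑ j, v i * u j * ((S.c i j * (S.len2 j : ℤ) : ℤ) : ℝ)) / 2

/-- the simple reflection `σ_k` as a linear map on `Λ ⊗ ℝ`, in root coordinates. -/
def sMap (k : Fin S.r) : (Fin S.r → ℝ) →ₗ[ℝ] (Fin S.r → ℝ) where
  toFun v := fun i => v i - (if i = k then ∑ j, v j * (S.c j k : ℝ) else 0)
  map_add' v w := by
    funext i
    by_cases h : i = k
    · simp only [h, Pi.add_apply, if_pos, add_mul, Finset.sum_add_distrib]
      ring
    · simp [h]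
  map_smul' t v := by
    funext i
    by_cases h : i = k
    · simp only [h, Pi.smul_apply, smul_eq_mul, RingHom.id_apply, if_pos, mul_assoc,
        ← Finset.mul_sum]
      ring
    · simp [h]

lemma sMap_invol (k : Fin S.r) : Function.Involutive (S.sMap k) := by
  intro v
  funext i
  simp only [sMap, LinearMap.coe_mk, AddHom.coe_mk]
  by_cases h : i = k
  · subst h
    simp only [if_pos rfl]
    have key : (∑ j, (v j - (if j = i then (∑ m, v m * (S.c m i : ℝ)) else 0)) * (S.c j i : ℝ))
        = (∑ j, v j * (S.c j i : ℝ)) - (∑ m, v m * (S.c m i : ℝ)) * (S.c i i : ℝ) := by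
      have e : ∀ j ∈ Finset.univ,
          (v j - (if j = i then (∑ m, v m * (S.c m i : ℝ)) else 0)) * (S.c j i : ℝ)
            = v j * (S.c j i : ℝ) -
              (if j = i then (∑ m, v m * (S.c m i : ℝ)) * (S.c j i : ℝ) else 0) := by
        intro j _
        by_cases hj : j = i
        · simp only [hj, if_pos]
          ring
        · simp [hj]
      rw [Finset.sum_congr rfl e, Finset.sum_sub_distrib,
        Finset.sum_ite_eq' Finset.univ i
          (fun j => (∑ m, v m * (S.c m i : ℝ)) * (S.c j i : ℝ))]
      simp
    rw [key, S.hcdiag i]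
    push_cast
    ring
  · simp [h]

/-- the simple reflection `σ_k`, as a linear automorphism of `Λ ⊗ ℝ`. -/
def sigma (k : Fin S.r) : (Fin S.r → ℝ) ≃ₗ[ℝ] (Fin S.r → ℝ) :=
  { S.sMap k with
    invFun := S.sMap k
    left_inv := S.sMap_invol k
    right_inv := S.sMap_invol k }

/-- the Weyl group `W`, the group of automorphisms of `Λ ⊗ ℝ` generated by the
simple reflections. -/
def Wgrp : Subgroup ((Fin S.r → ℝ) ≃ₗ[ℝ] (Fin S.r → ℝ)) :=
  Subgroup.closure (Set.range S.sigma)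

/-- the length function on the Weyl group: the number of simple reflections in a
reduced expression. -/
def len (w : (Fin S.r → ℝ) ≃ₗ[ℝ] (Fin S.r → ℝ)) : ℕ :=
  sInf {m | ∃ f : Fin m → Fin S.r, w = (List.ofFn fun i => S.sigma (f i)).prod}

/-- `n(α_k) = n / gcd(n, ‖α_k‖²)` for a simple root. -/
def nk (k : Fin S.r) : ℕ := S.n / Nat.gcd S.n (S.len2 k)

/-- `‖α‖²` for an element of the root lattice (integer-valued on roots). -/
def rootLen2 (a : Fin S.r → ℤ) : ℤ := (∑ i, ∑ j, a i * a j * (S.c i j * (S.len2 j : ℤ))) / 2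

/-- `n(α) = n / gcd(n, ‖α‖²)`. -/
def nroot (a : Fin S.r → ℤ) : ℕ := S.n / Nat.gcd S.n (S.rootLen2 a).toNat

/-- `δ_k(λ) = d(σ_k•λ − λ) = l_k + 1 − Σ_j λ_j c_{jk}`, for the twisting parameter
`ℓ = Lt`. -/
def delta (Lt : Fin S.r → ℕ) (k : Fin S.r) (lam : Fin S.r → ℤ) : ℤ :=
  (Lt k : ℤ) + 1 - ∑ j, lam j * S.c j k

/-- the twisted action `σ_k • λ = σ_k λ + (l_k+1) α_k` on the root lattice. -/
def bull (Lt : Fin S.r → ℕ) (k : Fin S.r) (lam : Fin S.r → ℤ) : Fin S.r → ℤ :=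
  fun i => lam i + (if i = k then S.delta Lt k lam else 0)

/-- `d_θ(α) = ⟨θ, α⟩` for `θ = Σ (l_i+1)ϖ_i` (integer-valued on roots). -/
def dθ (Lt : Fin S.r → ℕ) (a : Fin S.r → ℤ) : ℤ :=
  (∑ j, a j * ((Lt j : ℤ) + 1) * (S.len2 j : ℤ)) / S.rootLen2 a

/-- the normalized Gauss sum `g*_t(p)`. -/
def gs (t : ℤ) : ℂ := if (S.n : ℤ) ∣ t then -1 else S.g t / (S.p : ℂ)

/-- the recurrence relations of Theorem 3.1 for a coefficient function `b` and
twisting parameter `Lt`. -/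
def SatRec (Lt : Fin S.r → ℕ) (b : (Fin S.r → ℤ) → ℂ) : Prop :=
  ∀ (k : Fin S.r) (lam : Fin S.r → ℤ),
    (S.delta Lt k lam % (S.nk k : ℤ) = 0 →
      -(S.p : ℂ) ^ (1 + (S.nk k : ℤ)) * b (lam - (S.nk k : ℤ) • S.az k) + b lam =
        -(S.p : ℂ) ^ (1 - S.delta Lt k lam) *
          (b (S.bull Lt k lam) -
            (S.p : ℂ) ^ (-(1 + (S.nk k : ℤ))) * b (S.bull Lt k lam + (S.nk k : ℤ) • S.az k))) ∧
    (S.delta Lt k lam % (S.nk k : ℤ) ≠ 0 →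
      S.gs (-(S.len2 k : ℤ) * S.delta Lt k lam) *
          (S.p : ℂ) ^ (1 + ((S.nk k : ℤ) - S.delta Lt k lam % (S.nk k : ℤ))) *
          b (lam - ((S.nk k : ℤ) - S.delta Lt k lam % (S.nk k : ℤ)) • S.az k) + b lam =
        S.gs (-(S.len2 k : ℤ) * S.delta Lt k lam) * (S.p : ℂ) ^ (1 - S.delta Lt k lam) *
          (b (S.bull Lt k lam) +
            (S.gs (-(S.len2 k : ℤ) * S.delta Lt k lam))⁻¹ *
              (S.p : ℂ) ^ (-(1 + ((S.nk k : ℤ) - S.delta Lt k lam % (S.nk k : ℤ)))) *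
              b (S.bull Lt k lam + ((S.nk k : ℤ) - S.delta Lt k lam % (S.nk k : ℤ)) • S.az k)))

/-- the field `Ã` of rational functions on the root lattice: the fraction field of
`A = ℂ[Λ]` (realized as the fraction field of a polynomial ring, in which monomials
with arbitrary integer exponents make sense). -/
abbrev K := FractionRing (MvPolynomial (Fin S.r) ℂ)

/-- the coordinate `x_k = x^{α_k}`. -/
def Xk (i : Fin S.r) : S.K := algebraMap (MvPolynomial (Fin S.r) ℂ) S.K (MvPolynomial.X i)

/-- a constant (element of `ℂ`) viewed in `Ã`. -/
def cst (z : ℂ) : S.K := algebraMap (MvPolynomial (Fin S.r) ℂ) S.K (MvPolynomial.C z)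

/-- `|p|` viewed in `Ã`. -/
def pK : S.K := S.cst (S.p : ℂ)

/-- the monomial `x^λ` for `λ` in the root lattice. -/
def mono (lam : Fin S.r → ℤ) : S.K := ∏ i, S.Xk i ^ lam i

/-- the rational function `P_{β,ℓ,k}(x_k)` of Chinta–Gunnells. -/
def Pfun (Lt : Fin S.r → ℕ) (k : Fin S.r) (β : Fin S.r → ℤ) : S.K :=
  (1 - S.pK⁻¹) * (S.pK * S.Xk k) ^ ((Lt k : ℤ) + 1 - S.delta Lt k β % (S.nk k : ℤ)) /
    (1 - (S.pK * S.Xk k) ^ (S.nk k : ℤ) / S.pK)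

/-- the rational function `Q_{β,ℓ,k}(x_k)` of Chinta–Gunnells. -/
def Qfun (Lt : Fin S.r → ℕ) (k : Fin S.r) (β : Fin S.r → ℤ) : S.K :=
  -(S.cst (S.gs (-(S.len2 k : ℤ) * S.delta Lt k β))) *
      (S.pK * S.Xk k) ^ ((Lt k : ℤ) + 1 - (S.nk k : ℤ)) *
      (1 - (S.pK * S.Xk k) ^ (S.nk k : ℤ)) /
    (1 - (S.pK * S.Xk k) ^ (S.nk k : ℤ) / S.pK)

end Setup

/-- The data of a `Setup` together with: the fundamental weights `wt i = ϖ_i`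
(in root coordinates), the (finite) Weyl group as a finite set `Wfin`, and the
(finite) set of roots `Phi = Φ ⊂ Λ`. -/
structure Data extends Setup where
  /-- the fundamental weights `ϖ_i ∈ Λ ⊗ ℝ`, in root coordinates. -/
  wt : Fin toSetup.r → (Fin toSetup.r → ℝ)
  hwt : ∀ i j, (∑ m, wt i m * (toSetup.c m j : ℝ)) = if i = j then 1 else 0
  /-- the Weyl group, as a finite set. -/
  Wfin : Finset ((Fin toSetup.r → ℝ) ≃ₗ[ℝ] (Fin toSetup.r → ℝ))
  hWfin : ∀ u, u ∈ Wfin ↔ u ∈ toSetup.Wgrp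
  /-- the set `Φ` of roots, inside the root lattice. -/
  Phi : Finset (Fin toSetup.r → ℤ)
  hPhi : ∀ a, a ∈ Phi ↔ ∃ w ∈ toSetup.Wgrp, ∃ i, toSetup.coeV a = w (toSetup.av i)

namespace Data

variable (D : Data)

/-- `θ = Σ (l_i + 1) ϖ_i`, a strongly dominant weight. -/
def θv (Lt : Fin D.r → ℕ) : Fin D.r → ℝ := ∑ i, ((Lt i : ℝ) + 1) • D.wt i

/-- the polytope `Π_θ`: the convex hull of `{θ - wθ : w ∈ W}`. -/
def PiTheta (Lt : Fin D.r → ℕ) : Set (Fin D.r → ℝ) :=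
  convexHull ℝ {v | ∃ w ∈ D.toSetup.Wgrp, v = D.θv Lt - w (D.θv Lt)}

/-- the set `Θ⁺` of regular dominant weights of the representation of highest weight
`θ(Lt)`, encoded as pairs `q = (L, μ)` where the weight is `ξ = θ(L) = Σ (L_i+1)ϖ_i`
(automatically regular and dominant) and `μ ∈ ℕ^r` gives the coordinates of
`θ - ξ = Σ μ_i α_i` (so that `ξ ≼ θ`). -/
def ThetaPairs (Lt : Fin D.r → ℕ) : Set ((Fin D.r → ℕ) × (Fin D.r → ℕ)) :=
  {q | (fun i => (q.2 i : ℝ)) = D.θv Lt - D.θv q.1}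

/-- the positive roots. -/
def PhiPos : Finset (Fin D.r → ℤ) := D.Phi.filter fun a => ∀ i, 0 ≤ a i

/-- `Φ(w)`: positive roots sent to negative roots by `w`. -/
def PhiW (w : (Fin D.r → ℝ) ≃ₗ[ℝ] (Fin D.r → ℝ)) : Finset (Fin D.r → ℤ) :=
  D.PhiPos.filter fun a => ∃ i, (w (D.toSetup.coeV a)) i < 0

/-- `j(w, x) = sgn(w) ∏_{α ∈ Φ(w)} |p|^{n(α)d(α)} x^{n(α)α}`. -/
def jfun (w : (Fin D.r → ℝ) ≃ₗ[ℝ] (Fin D.r → ℝ)) : D.toSetup.K :=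
  (-1 : D.toSetup.K) ^ (D.PhiW w).card *
    ∏ a ∈ D.PhiW w,
      D.toSetup.pK ^ ((D.toSetup.nroot a : ℤ) * D.toSetup.ht a) *
        D.toSetup.mono ((D.toSetup.nroot a : ℤ) • a)

/-- `Δ(x) = ∏_{α>0} (1 − |p|^{n(α)d(α)} x^{n(α)α})`. -/
def Δfun : D.toSetup.K :=
  ∏ a ∈ D.PhiPos,
    (1 - D.toSetup.pK ^ ((D.toSetup.nroot a : ℤ) * D.toSetup.ht a) *
      D.toSetup.mono ((D.toSetup.nroot a : ℤ) • a))

/-- `D(x) = ∏_{α>0} (1 − |p|^{n(α)d(α)−1} x^{n(α)α})`. -/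
def Dfun : D.toSetup.K :=
  ∏ a ∈ D.PhiPos,
    (1 - D.toSetup.pK ^ ((D.toSetup.nroot a : ℤ) * D.toSetup.ht a - 1) *
      D.toSetup.mono ((D.toSetup.nroot a : ℤ) • a))

/-- the sublattice `Λ' ⊆ Λ` generated by `{n(α)α : α ∈ Φ}`. -/
def Lam' : AddSubgroup (Fin D.r → ℤ) :=
  AddSubgroup.closure {x | ∃ a ∈ D.Phi, x = (D.toSetup.nroot a : ℤ) • a}

/-- the graded piece `Ã_0`: rational functions `f/g` with the supports of `f` and `g`
contained in `Λ'`. -/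
def A0 : Subfield D.toSetup.K :=
  Subfield.closure {h | ∃ lam ∈ D.Lam', h = D.toSetup.mono lam}

/-- the graded piece `Ã_β = x^β Ã_0`. -/
def piece (β : Fin D.r → ℤ) : Set D.toSetup.K :=
  {h | ∃ g ∈ D.A0, h = D.toSetup.mono β * g}

end Data

/-- The data of a `Data` together with: the change-of-variables action `covW` of the
Weyl group on `Ã` (with `(σ_j x)_i = |p|^{-c_{ij}} x_i x_j^{-c_{ij}}`), and the
Chinta–Gunnells action `act ℓ` of the Weyl group on `Ã` for each twisting parameter
`ℓ`, characterized by `(f |_ℓ σ_k)(x) = (P_{β,ℓ,k}(x_k) + Q_{σ_k•β,ℓ,k}(x_k)) f(σ_k x)`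
for `f ∈ Ã_β`. -/
structure CG extends Data where
  /-- the change of variables `f(x) ↦ f(wx)`. -/
  covW : ((Fin toSetup.r → ℝ) ≃ₗ[ℝ] (Fin toSetup.r → ℝ)) → (toSetup.K ≃+* toSetup.K)
  hcovW_cst : ∀ w z, covW w (toSetup.cst z) = toSetup.cst z
  hcovW_gen : ∀ k i, covW (toSetup.sigma k) (toSetup.Xk i) =
      toSetup.pK ^ (-(toSetup.c i k)) * toSetup.Xk i * toSetup.Xk k ^ (-(toSetup.c i k))
  hcovW_one : ∀ f, covW 1 f = f
  hcovW_mul : ∀ w w', w ∈ toSetup.Wgrp → w' ∈ toSetup.Wgrp →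
      ∀ f, covW (w * w') f = covW w' (covW w f)
  /-- the Chinta–Gunnells action `f ↦ (f |_ℓ w)`, for each twisting parameter. -/
  act : (Fin toSetup.r → ℕ) → ((Fin toSetup.r → ℝ) ≃ₗ[ℝ] (Fin toSetup.r → ℝ)) →
      toSetup.K → toSetup.K
  hact_add : ∀ Lt w f h, act Lt w (f + h) = act Lt w f + act Lt w h
  hact_cst : ∀ Lt w z f, act Lt w (toSetup.cst z * f) = toSetup.cst z * act Lt w f
  hact_one : ∀ Lt f, act Lt 1 f = f
  hact_mul : ∀ Lt w w', w ∈ toSetup.Wgrp → w' ∈ toSetup.Wgrp →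
      ∀ f, act Lt (w * w') f = act Lt w' (act Lt w f)
  hact_gen : ∀ Lt k β f, f ∈ toData.piece β →
      act Lt (toSetup.sigma k) f =
        (toSetup.Pfun Lt k β + toSetup.Qfun Lt k (toSetup.bull Lt k β)) *
          covW (toSetup.sigma k) f

namespace CG

variable (C : CG)

/-- the invariant function `F(x; ℓ) = Δ(x)⁻¹ Σ_{w ∈ W} j(w,x) (1 |_ℓ w)(x)`. -/
def Ffun (Lt : Fin C.r → ℕ) : C.toSetup.K :=
  (C.toData.Δfun)⁻¹ * ∑ w ∈ C.Wfin, C.toData.jfun w * C.act Lt w 1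

/-- the `p`-part `N(x; ℓ) = F(x; ℓ) D(x)`. -/
def Nfun (Lt : Fin C.r → ℕ) : C.toSetup.K := C.Ffun Lt * C.toData.Dfun

/-- `a` is the (finitely supported) coefficient function of `h`, i.e.
`h = Σ_λ a_λ x^λ`. -/
def represents (h : C.toSetup.K) (a : (Fin C.r → ℤ) →₀ ℂ) : Prop :=
  h = ∑ lam ∈ a.support, C.toSetup.cst (a lam) * C.toSetup.mono lam

end CG

end CGMDS


namespace CGMDS

theorem dvd_sum_symm {ι : Type*} [DecidableEq ι] (f : ι → ι → ℤ) (M : ℤ)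
    (hs : ∀ i j, f i j = f j i) (h1 : ∀ i j, M ∣ f i j) (h2 : ∀ i, 2 * M ∣ f i i)
    (s : Finset ι) : 2 * M ∣ ∑ i ∈ s, ∑ j ∈ s, f i j := by
  induction s using Finset.induction_on with
  | empty => simp
  | insert a s ha ih =>
    have e : ∑ i ∈ insert a s, ∑ j ∈ insert a s, f i j
        = f a a + 2 * (∑ j ∈ s, f a j) + ∑ i ∈ s, ∑ j ∈ s, f i j := by
      rw [Finset.sum_insert ha, Finset.sum_insert ha]
      have : ∑ i ∈ s, ∑ j ∈ insert a s, f i j = ∑ i ∈ s, f a i + ∑ i ∈ s, ∑ j ∈ s, f i j := by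
        rw [← Finset.sum_add_distrib]
        refine Finset.sum_congr rfl fun i _ => ?_
        rw [Finset.sum_insert ha, hs i a]
      rw [this]; ring
    rw [e]
    refine dvd_add (dvd_add (h2 a) ?_) ih
    exact mul_dvd_mul_left 2 (Finset.dvd_sum fun j _ => h1 a j)

namespace Setup

variable (S : Setup)

theorem B_add_left (u v x : Fin S.r → ℝ) : S.B (u + v) x = S.B u x + S.B v x := by
  simp only [B, Pi.add_apply, add_mul, Finset.sum_add_distrib, add_div]

theorem B_smul_left (t : ℝ) (v x : Fin S.r → ℝ) : S.B (t • v) x = t * S.B v x := by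
  simp only [B, Pi.smul_apply, smul_eq_mul, mul_assoc, ← Finset.mul_sum, mul_div_assoc]

theorem B_comm (u v : Fin S.r → ℝ) : S.B u v = S.B v u := by
  unfold B
  rw [Finset.sum_comm]
  congr 1
  refine Finset.sum_congr rfl fun i _ => Finset.sum_congr rfl fun j _ => ?_
  rw [S.hsym j i]; ring

theorem B_add_right (u v x : Fin S.r → ℝ) : S.B x (u + v) = S.B x u + S.B x v := by
  rw [B_comm, B_add_left, S.B_comm u, S.B_comm v]

theorem B_smul_right (t : ℝ) (v x : Fin S.r → ℝ) : S.B x (t • v) = t * S.B x v := by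
  rw [B_comm, B_smul_left, S.B_comm v]

theorem B_neg_left (v x : Fin S.r → ℝ) : S.B (-v) x = - S.B v x := by
  rw [← neg_one_smul ℝ v, B_smul_left]; ring

theorem B_neg_right (v x : Fin S.r → ℝ) : S.B x (-v) = - S.B x v := by
  rw [B_comm, B_neg_left, B_comm]

theorem B_sub_left (u v x : Fin S.r → ℝ) : S.B (u - v) x = S.B u x - S.B v x := by
  rw [sub_eq_add_neg, B_add_left, B_neg_left]; ring

theorem B_sub_right (u v x : Fin S.r → ℝ) : S.B x (u - v) = S.B x u - S.B x v := by
  rw [sub_eq_add_neg, B_add_right, B_neg_right]; ring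

theorem B_pos (v : Fin S.r → ℝ) (hv : v ≠ 0) : 0 < S.B v v :=
  half_pos (S.hposdef v hv)

theorem B_nonneg (v : Fin S.r → ℝ) : 0 ≤ S.B v v := by
  by_cases h : v = 0
  · simp [h, B]
  · exact (S.B_pos v h).le

/-- the pairing `⟨v, α_k⟩`. -/
def pr (v : Fin S.r → ℝ) (k : Fin S.r) : ℝ := ∑ j, v j * (S.c j k : ℝ)

theorem B_av (v : Fin S.r → ℝ) (k : Fin S.r) : S.B v (S.av k) = S.pr v k * S.len2 k / 2 := by
  simp only [B, av, pr, Finset.sum_mul]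
  congr 1
  refine Finset.sum_congr rfl fun i _ => ?_
  rw [Finset.sum_eq_single k]
  · simp; ring
  · intro j _ hj; simp [hj]
  · simp

theorem B_expand (v u : Fin S.r → ℝ) : S.B v u = ∑ j, u j * (S.pr v j * S.len2 j / 2) := by
  simp only [B, pr]
  rw [Finset.sum_comm, Finset.sum_div]
  refine Finset.sum_congr rfl fun j _ => ?_
  simp only [Finset.sum_mul, Finset.sum_div, Finset.mul_sum]
  refine Finset.sum_congr rfl fun i _ => ?_
  push_cast; ring

theorem B_av_av (k : Fin S.r) : S.B (S.av k) (S.av k) = S.len2 k := by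
  rw [B_av, pr, Finset.sum_eq_single k]
  · simp [av, S.hcdiag k]
  · intro j _ hj; simp [av, hj]
  · simp

theorem sigma_apply (k : Fin S.r) (v : Fin S.r → ℝ) :
    S.sigma k v = v - S.pr v k • S.av k := by
  funext i
  change v i - (if i = k then ∑ j, v j * (S.c j k : ℝ) else 0) = _
  by_cases h : i = k
  · subst h; simp [av, pr]
  · simp [av, h]

theorem len2_pos (k : Fin S.r) : (0 : ℝ) < S.len2 k := by exact_mod_cast S.hlen2 k

theorem sigma_sq (k : Fin S.r) (v : Fin S.r → ℝ) : S.sigma k (S.sigma k v) = v :=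
  S.sMap_invol k v

theorem sigma_mul_self (k : Fin S.r) : S.sigma k * S.sigma k = 1 := by
  ext v : 1
  exact S.sigma_sq k v

theorem sigma_inv (k : Fin S.r) : (S.sigma k)⁻¹ = S.sigma k :=
  inv_eq_of_mul_eq_one_left (S.sigma_mul_self k)

theorem B_sigma (k : Fin S.r) (u v : Fin S.r → ℝ) :
    S.B (S.sigma k u) (S.sigma k v) = S.B u v := by
  simp only [sigma_apply, B_sub_left, B_sub_right, B_smul_left, B_smul_right, B_av_av]
  rw [S.B_comm (S.av k) v, B_av, B_av]; ring

/-- product of a word of simple reflections. -/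
def Pw (L : List (Fin S.r)) : (Fin S.r → ℝ) ≃ₗ[ℝ] (Fin S.r → ℝ) := (L.map S.sigma).prod

theorem Pw_cons (j : Fin S.r) (L : List (Fin S.r)) : S.Pw (j :: L) = S.sigma j * S.Pw L := by
  simp [Pw]

theorem Pw_inv (L : List (Fin S.r)) : (S.Pw L)⁻¹ = S.Pw L.reverse := by
  induction L with
  | nil => simp [Pw]
  | cons j L ih =>
    rw [Pw_cons, mul_inv_rev, ih, sigma_inv]; simp [Pw]

theorem B_Pw (L : List (Fin S.r)) (u v : Fin S.r → ℝ) :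
    S.B (S.Pw L u) (S.Pw L v) = S.B u v := by
  induction L with
  | nil => simp [Pw]
  | cons j L ih =>
    rw [Pw_cons, LinearEquiv.mul_apply, LinearEquiv.mul_apply, B_sigma, ih]

theorem exists_word (w : (Fin S.r → ℝ) ≃ₗ[ℝ] (Fin S.r → ℝ)) (hw : w ∈ S.Wgrp) :
    ∃ L, w = S.Pw L := by
  induction hw using Subgroup.closure_induction with
  | mem x hx => obtain ⟨k, rfl⟩ := hx; exact ⟨[k], by simp [Pw]⟩
  | one => exact ⟨[], by simp [Pw]⟩
  | mul x y _ _ hx hy =>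
    obtain ⟨L, rfl⟩ := hx
    obtain ⟨L', rfl⟩ := hy
    exact ⟨L ++ L', by simp [Pw]⟩
  | inv x _ hx =>
    obtain ⟨L, rfl⟩ := hx
    exact ⟨L.reverse, S.Pw_inv L⟩

theorem len_le (L : List (Fin S.r)) : S.len (S.Pw L) ≤ L.length := by
  refine Nat.sInf_le ⟨L.get, ?_⟩
  have : (List.ofFn fun i => S.sigma (L.get i)) = L.map S.sigma := by
    apply List.ext_get <;> simp
  rw [this, Pw]

theorem exists_reduced (w : (Fin S.r → ℝ) ≃ₗ[ℝ] (Fin S.r → ℝ)) (hw : w ∈ S.Wgrp) :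
    ∃ L, w = S.Pw L ∧ L.length = S.len w := by
  have hne : {m | ∃ f : Fin m → Fin S.r,
      w = (List.ofFn fun i => S.sigma (f i)).prod}.Nonempty := by
    obtain ⟨L, rfl⟩ := S.exists_word w hw
    refine ⟨L.length, L.get, ?_⟩
    rw [Pw]; congr 1
    apply List.ext_get <;> simp
  obtain ⟨f, hf⟩ := Nat.sInf_mem hne
  refine ⟨List.ofFn f, ?_, by simp [len]⟩
  rw [Pw, List.map_ofFn]; exact hf

/-- roots: the orbit of the simple roots. -/
def IsRt (β : Fin S.r → ℝ) : Prop := ∃ L i, β = S.Pw L (S.av i)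

theorem IsRt.sigma {S : Setup} {β : Fin S.r → ℝ} (h : S.IsRt β) (k : Fin S.r) :
    S.IsRt (S.sigma k β) := by
  obtain ⟨L, i, rfl⟩ := h
  exact ⟨k :: L, i, by rw [Pw_cons, LinearEquiv.mul_apply]⟩

/-- integrality of the coordinates of roots and coroots. -/
theorem lat (i : Fin S.r) (L : List (Fin S.r)) :
    ∃ a : Fin S.r → ℤ, S.Pw L (S.av i) = S.coeV a ∧
      ∀ j, (S.len2 i : ℤ) ∣ a j * S.len2 j := by
  induction L with
  | nil =>
    refine ⟨S.az i, ?_, ?_⟩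
    · funext j
      by_cases h : j = i
      · subst h; simp [Pw, av, coeV, az]
      · simp [Pw, av, coeV, az, h]
    · intro j
      by_cases h : j = i
      · subst h; simp [az]
      · simp [az, h]
  | cons k L ih =>
    obtain ⟨a, ha, hd⟩ := ih
    refine ⟨fun j => a j - (if j = k then ∑ m, a m * S.c m k else 0), ?_, ?_⟩
    · rw [Pw_cons, LinearEquiv.mul_apply, ha, sigma_apply]
      funext j
      by_cases h : j = k
      · subst h; simp [coeV, av, pr]
      · simp [coeV, av, h]
    · intro j
      by_cases h : j = k
      · subst h
        simp only [if_true, sub_mul, Finset.sum_mul]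
        refine dvd_sub (hd j) (Finset.dvd_sum fun m _ => ?_)
        rw [mul_assoc, S.hsym m j, mul_left_comm]
        exact (hd m).mul_left _
      · simpa [h] using hd j

theorem B_int_ge (M : ℕ) (a : Fin S.r → ℤ) (h0 : a ≠ 0)
    (hd : ∀ j, (M : ℤ) ∣ a j * S.len2 j) : (M : ℝ) ≤ S.B (S.coeV a) (S.coeV a) := by
  have hne : S.coeV a ≠ 0 := by
    intro h
    apply h0
    funext i
    have := congrFun h i
    simpa [coeV] using this
  have hp := S.B_pos _ hne
  set T : ℤ := ∑ i, ∑ j, a i * a j * (S.c i j * (S.len2 j : ℤ)) with hT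
  have hB : S.B (S.coeV a) (S.coeV a) = (T : ℝ) / 2 := by
    rw [hT]; simp [B, coeV]
  have hdv : 2 * (M : ℤ) ∣ T := by
    refine dvd_sum_symm (fun i j => a i * a j * (S.c i j * (S.len2 j : ℤ))) M ?_ ?_ ?_ _
    · intro i j
      rw [S.hsym i j]; ring
    · intro i j
      have : a i * a j * (S.c i j * (S.len2 j : ℤ)) = (a i * S.c i j) * (a j * S.len2 j) := by ring
      simp only [this]
      exact (hd j).mul_left _
    · intro i
      have : a i * a i * (S.c i i * (S.len2 i : ℤ)) = 2 * (a i * S.len2 i) * a i := by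
        rw [S.hcdiag]; ring
      simp only [this]
      exact (mul_dvd_mul_left 2 (hd i)).mul_right _
  rw [hB] at hp ⊢
  have hTpos : 0 < T := by
    have : (0 : ℝ) < T := by linarith
    exact_mod_cast this
  have := Int.le_of_dvd hTpos hdv
  have h3 : 2 * (M : ℝ) ≤ T := by exact_mod_cast this
  linarith

theorem IsRt.sign {S : Setup} {β : Fin S.r → ℝ} (h : S.IsRt β) :
    (∀ i, 0 ≤ β i) ∨ (∀ i, β i ≤ 0) := by
  obtain ⟨L, i, rfl⟩ := h
  obtain ⟨a, ha, hd⟩ := S.lat i L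
  have hq : S.B (S.coeV a) (S.coeV a) = S.len2 i := by rw [← ha, B_Pw, B_av_av]
  rw [ha]
  set p : Fin S.r → ℤ := fun j => max (a j) 0 with hp
  set m : Fin S.r → ℤ := fun j => max (-a j) 0 with hm
  by_cases hp0 : p = 0
  · right
    intro j
    have := congrFun hp0 j
    simp only [hp, Pi.zero_apply, max_eq_right_iff] at this
    simpa [coeV] using this
  by_cases hm0 : m = 0
  · left
    intro j
    have := congrFun hm0 j
    simp only [hm, Pi.zero_apply, max_eq_right_iff] at this
    simpa [coeV] using this
  exfalso
  have h1 := S.B_int_ge (S.len2 i) p hp0 (by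
    intro j
    rcases max_choice (a j) 0 with h | h
    · simp only [hp, h]; exact hd j
    · simp only [hp, h]; simp)
  have h2 := S.B_int_ge (S.len2 i) m hm0 (by
    intro j
    rcases max_choice (-a j) 0 with h | h
    · simp only [hm, h, neg_mul]; exact (hd j).neg_right
    · simp only [hm, h]; simp)
  have e : S.coeV a = S.coeV p - S.coeV m := by
    funext j
    have : a j = p j - m j := by simp only [hp, hm]; omega
    simp [coeV, this]
  have h3 : S.B (S.coeV p) (S.coeV m) ≤ 0 := by
    unfold B
    apply div_nonpos_of_nonpos_of_nonneg _ (by norm_num)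
    refine Finset.sum_nonpos fun x _ => Finset.sum_nonpos fun y _ => ?_
    by_cases hxy : x = y
    · subst hxy
      have : p x * m x = 0 := by
        rcases le_total (a x) 0 with h | h
        · simp [hp, h]
        · simp [hm, h]
      have : S.coeV p x * S.coeV m x = 0 := by simp only [coeV]; exact_mod_cast this
      rw [this]; simp
    · have c1 : S.c x y * (S.len2 y : ℤ) ≤ 0 :=
        mul_nonpos_of_nonpos_of_nonneg (S.hcoff x y hxy) (by positivity)
      apply mul_nonpos_of_nonneg_of_nonpos
      · apply mul_nonneg <;> simp [coeV, hp, hm]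
      · exact_mod_cast c1
  have hl := S.len2_pos i
  rw [e, B_sub_left, B_sub_right, B_sub_right, S.B_comm (S.coeV m) (S.coeV p)] at hq
  linarith

theorem IsRt.ne_zero {S : Setup} {β : Fin S.r → ℝ} (h : S.IsRt β) : 0 < S.B β β := by
  obtain ⟨L, i, rfl⟩ := h
  rw [B_Pw, B_av_av]; exact S.len2_pos i

/-- the exchange lemma. -/
theorem exch (L : List (Fin S.r)) : ∀ β, S.IsRt β → (∀ i, 0 ≤ β i) →
    (∀ i, (S.Pw L)⁻¹ β i ≤ 0) →
    ∃ L' : List (Fin S.r), L'.length + 1 = L.length ∧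
      ∀ v, S.Pw L v - (2 * S.B (S.Pw L v) β / S.B β β) • β = S.Pw L' v := by
  induction L with
  | nil =>
    intro β hβ h0 h1
    exfalso
    have : β = 0 := by
      funext i
      exact le_antisymm (by simpa [Pw] using h1 i) (h0 i)
    have h2 := hβ.ne_zero
    rw [this] at h2
    simp [B] at h2
  | cons j L ih =>
    intro β hβ h0 h1
    have e1 : (S.Pw (j :: L))⁻¹ β = (S.Pw L)⁻¹ (S.sigma j β) := by
      rw [Pw_cons, mul_inv_rev, sigma_inv, LinearEquiv.mul_apply]
    rw [e1] at h1
    rcases (hβ.sigma j).sign with hs | hs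
    · obtain ⟨L', hL, hv⟩ := ih _ (hβ.sigma j) hs h1
      refine ⟨j :: L', by simp [hL], fun v => ?_⟩
      rw [Pw_cons, Pw_cons, LinearEquiv.mul_apply, LinearEquiv.mul_apply, ← hv v, map_sub,
        map_smul, sigma_sq, B_sigma]
      have : S.B (S.Pw L v) (S.sigma j β) = S.B (S.sigma j (S.Pw L v)) β := by
        rw [← S.B_sigma j, sigma_sq]
      rw [this]
    · refine ⟨L, by simp, fun v => ?_⟩
      have hb : β = β j • S.av j := by
        funext i
        by_cases h : i = j
        · subst h; simp [av]
        · have := hs i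
          rw [sigma_apply] at this
          simp [av, h] at this
          simp [av, h, le_antisymm this (h0 i)]
      have ht : β j ≠ 0 := by
        intro h
        have h2 := hβ.ne_zero
        rw [hb, h] at h2
        simp [B] at h2
      have hl := (S.len2_pos j).ne'
      rw [Pw_cons, LinearEquiv.mul_apply]
      set x := S.sigma j (S.Pw L v) with hx
      have hxx : S.Pw L v = S.sigma j x := by rw [hx, sigma_sq]
      rw [hxx, sigma_apply]
      generalize β j = t at *
      subst hb
      have hbb : S.B (t • S.av j) (t • S.av j) = t * (t * S.len2 j) := by
        rw [B_smul_left, B_smul_right, B_av_av]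
      rw [hbb, B_smul_right, B_av, smul_smul]
      congr 2
      field_simp

/-- `l(σ_k w) < l(w)` forces `w⁻¹α_k` to be negative. -/
theorem neg_of_len_lt (w : (Fin S.r → ℝ) ≃ₗ[ℝ] (Fin S.r → ℝ)) (hw : w ∈ S.Wgrp) (k : Fin S.r)
    (hk : S.len (S.sigma k * w) < S.len w) : ∀ i, w⁻¹ (S.av k) i ≤ 0 := by
  have hrt0 : S.IsRt (S.av k) := ⟨[], k, by simp [Pw]⟩
  have hrt : S.IsRt (w⁻¹ (S.av k)) := by
    obtain ⟨L, rfl⟩ := S.exists_word w hw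
    exact ⟨L.reverse, k, by rw [Pw_inv]⟩
  rcases hrt.sign with h | h
  swap
  · exact h
  exfalso
  have hu : S.sigma k * w ∈ S.Wgrp := mul_mem (Subgroup.subset_closure ⟨k, rfl⟩) hw
  obtain ⟨L, hL, hlen⟩ := S.exists_reduced _ hu
  have hsk : S.sigma k (S.av k) = - S.av k := by
    have h1 := S.B_av_av k
    rw [B_av] at h1
    have hl := S.len2_pos k
    have h2 : S.pr (S.av k) k = 2 := by
      field_simp at h1
      linarith
    rw [sigma_apply, h2, two_smul]; abel
  obtain ⟨L', hl', hv⟩ := S.exch L (S.av k) hrt0 (by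
      intro i
      by_cases h : i = k
      · subst h; simp [av]
      · simp [av, h]) (by
      intro i
      rw [← hL, mul_inv_rev, sigma_inv, LinearEquiv.mul_apply, hsk, map_neg]
      simpa using h i)
  have hwL : w = S.Pw L' := by
    ext v : 1
    rw [← hv v, ← hL, LinearEquiv.mul_apply]
    have h1 := S.sigma_sq k (w v)
    conv_lhs => rw [← h1]
    rw [S.sigma_apply k (S.sigma k (w v)), B_av, B_av_av]
    congr 2
    have hl := (S.len2_pos k).ne'
    field_simp
  have := S.len_le L'
  rw [← hwL] at this
  omega

end Setup

namespace Data

variable (D : Data)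

theorem pr_θ (Lt : Fin D.r → ℕ) (j : Fin D.r) : D.toSetup.pr (D.θv Lt) j = (Lt j : ℝ) + 1 := by
  simp only [Setup.pr, θv, Finset.sum_apply, Pi.smul_apply, smul_eq_mul, Finset.sum_mul]
  rw [Finset.sum_comm]
  simp only [mul_assoc, ← Finset.mul_sum, D.hwt]
  simp

theorem B_θ_nonpos (Lt : Fin D.r → ℕ) (v : Fin D.r → ℝ) (hv : ∀ i, v i ≤ 0) :
    D.toSetup.B (D.θv Lt) v ≤ 0 := by
  rw [Setup.B_expand]
  refine Finset.sum_nonpos fun j _ => mul_nonpos_of_nonpos_of_nonneg (hv j) ?_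
  rw [pr_θ]; positivity

theorem B_wθ_nonpos (Lt : Fin D.r → ℕ)
    (w : (Fin D.r → ℝ) ≃ₗ[ℝ] (Fin D.r → ℝ)) (hw : w ∈ D.toSetup.Wgrp) (k : Fin D.r)
    (hk : D.toSetup.len (D.toSetup.sigma k * w) < D.toSetup.len w) :
    D.toSetup.B (w (D.θv Lt)) (D.toSetup.av k) ≤ 0 := by
  have h := D.B_θ_nonpos Lt _ (D.toSetup.neg_of_len_lt w hw k hk)
  obtain ⟨L, rfl⟩ := D.toSetup.exists_word w hw
  rw [← D.toSetup.B_Pw L, ← LinearEquiv.mul_apply, mul_inv_cancel] at h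
  simpa using h

/-- every point of `Π_θ` is within distance `‖θ‖` of `θ`. -/
theorem norm_le (Lt : Fin D.r → ℕ) (x : Fin D.r → ℝ) (hx : x ∈ D.PiTheta Lt) :
    D.toSetup.B (D.θv Lt - x) (D.θv Lt - x) ≤ D.toSetup.B (D.θv Lt) (D.θv Lt) := by
  have hconv : Convex ℝ {x | D.toSetup.B (D.θv Lt - x) (D.θv Lt - x)
      ≤ D.toSetup.B (D.θv Lt) (D.θv Lt)} := by
    intro x hx y hy a b ha hb hab
    simp only [Set.mem_ofPred_eq] at *
    generalize D.toSetup.B (D.θv Lt) (D.θv Lt) = N at *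
    have e : D.θv Lt - (a • x + b • y) = a • (D.θv Lt - x) + b • (D.θv Lt - y) := by
      have : D.θv Lt = (a + b) • D.θv Lt := by rw [hab, one_smul]
      nth_rewrite 1 [this]
      module
    rw [e]
    generalize D.θv Lt - x = u at *
    generalize D.θv Lt - y = v at *
    have h := D.toSetup.B_nonneg (u - v)
    simp only [Setup.B_sub_left, Setup.B_sub_right, Setup.B_add_left, Setup.B_add_right,
      Setup.B_smul_left, Setup.B_smul_right, D.toSetup.B_comm v u] at *
    have hb' : b = 1 - a := by linarith
    subst hb'
    nlinarith [mul_nonneg (mul_nonneg ha hb) h, mul_le_mul_of_nonneg_left hx ha,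
      mul_le_mul_of_nonneg_left hy hb]
  refine convexHull_min ?_ hconv hx
  rintro _ ⟨w, hw, rfl⟩
  obtain ⟨L, rfl⟩ := D.toSetup.exists_word w hw
  simp only [Set.mem_ofPred_eq, sub_sub_cancel, Setup.B_Pw]
  exact le_rfl

end Data

end CGMDS

open CGMDS in
/-- **Lemma 3.5 of Chinta–Friedberg–Gunnells (boundedness of `Π_θ` along rays).**
Let `μ = θ − wθ` be a vertex of `Π_θ` and suppose `σ_k ∈ L(w)`, i.e.
`l(σ_k w) < l(w)`.  Then for every positive integer `b` the point `μ + bα_k` lies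
outside `Π_θ`; similarly, with `u = σ_k w` and `λ = θ − uθ`, the point `λ − bα_k`
lies outside `Π_θ`. -/
theorem statement_11 (D : Data) (ℓ : Fin D.r → ℕ)
    (w : (Fin D.r → ℝ) ≃ₗ[ℝ] (Fin D.r → ℝ)) (hw : w ∈ D.toSetup.Wgrp) (k : Fin D.r)
    (hk : D.toSetup.len (D.toSetup.sigma k * w) < D.toSetup.len w)
    (b : ℕ) (hb : 0 < b) :
    (D.θv ℓ - w (D.θv ℓ) + (b : ℝ) • D.toSetup.av k ∉ D.PiTheta ℓ) ∧
    (D.θv ℓ - (D.toSetup.sigma k * w) (D.θv ℓ) - (b : ℝ) • D.toSetup.av k ∉ D.PiTheta ℓ) := by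
  have hneg := D.B_wθ_nonpos ℓ w hw k hk
  have hbp : (0 : ℝ) < b := by exact_mod_cast hb
  have hl := D.toSetup.len2_pos k
  have hpos : 0 < (b : ℝ) * ((b : ℝ) * D.toSetup.len2 k) := by positivity
  have hwn : D.toSetup.B (w (D.θv ℓ)) (w (D.θv ℓ)) = D.toSetup.B (D.θv ℓ) (D.θv ℓ) := by
    obtain ⟨L, rfl⟩ := D.toSetup.exists_word w hw
    rw [Setup.B_Pw]
  have hmain : ∀ x, D.toSetup.B x x = D.toSetup.B (w (D.θv ℓ)) (w (D.θv ℓ)) +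
      (b : ℝ) * ((b : ℝ) * D.toSetup.len2 k) - 2 * (b : ℝ) *
      D.toSetup.B (w (D.θv ℓ)) (D.toSetup.av k) →
      D.θv ℓ - x ∉ D.PiTheta ℓ := by
    intro x hx hmem
    have h := D.norm_le ℓ _ hmem
    rw [sub_sub_cancel, hx, hwn] at h
    have := mul_nonneg hbp.le (neg_nonneg.mpr hneg)
    linarith
  constructor
  · rw [show D.θv ℓ - w (D.θv ℓ) + (b : ℝ) • D.toSetup.av k
        = D.θv ℓ - (w (D.θv ℓ) - (b : ℝ) • D.toSetup.av k) by abel]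
    apply hmain
    simp only [Setup.B_sub_left, Setup.B_sub_right, Setup.B_smul_left, Setup.B_smul_right,
      Setup.B_av_av, D.toSetup.B_comm (D.toSetup.av k)]
    ring
  · rw [sub_sub]
    apply hmain
    have hB := D.toSetup.B_sigma k (w (D.θv ℓ)) (w (D.θv ℓ))
    have hB2 : D.toSetup.B (D.toSetup.sigma k (w (D.θv ℓ))) (D.toSetup.av k)
        = - D.toSetup.B (w (D.θv ℓ)) (D.toSetup.av k) := by
      rw [Setup.sigma_apply, Setup.B_sub_left, Setup.B_smul_left, Setup.B_av_av, Setup.B_av]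
      ring
    simp only [LinearEquiv.mul_apply, Setup.B_add_left, Setup.B_add_right, Setup.B_smul_left,
      Setup.B_smul_right, Setup.B_av_av, D.toSetup.B_comm (D.toSetup.av k), hB, hB2]
    ring
end
end

section
/- For each simple reflection σ = σ_k, with α = α_k and m = n(α_k), the rational function D(x)/D(σx) equals |p|^{m+1} x^{mα} (1 − |p|^{m−1} x^{mα}) / (|p|^{m+1} x^{mα} − 1), where D(σx) denotes D evaluated after the change of variables (σ_k(x))_i = |p|^{−c_{ik}} x_i x_k^{−c_{ik}}. -/
open scoped BigOperators

noncomputable section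

namespace CGMDS

namespace Setup

variable (S : Setup)

/-- the Gram form (twice the inner product) on the root lattice. -/
def gram : LinearMap.BilinForm ℤ (Fin S.r → ℤ) :=
  Matrix.toBilin' (Matrix.of fun i j => S.c i j * (S.len2 j : ℤ))

lemma gram_apply (a e : Fin S.r → ℤ) :
    S.gram a e = ∑ i, ∑ j, a i * e j * (S.c i j * (S.len2 j : ℤ)) := by
  rw [gram, Matrix.toBilin'_apply]
  refine Finset.sum_congr rfl fun i _ => Finset.sum_congr rfl fun j _ => ?_
  simp only [Matrix.of_apply]
  ring

lemma gram_symm (a e : Fin S.r → ℤ) : S.gram a e = S.gram e a := by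
  rw [gram_apply, gram_apply, Finset.sum_comm]
  refine Finset.sum_congr rfl fun i _ => Finset.sum_congr rfl fun j _ => ?_
  rw [S.hsym j i]
  ring

/-- the pairing with the k-th simple coroot. -/
def prk (k : Fin S.r) (a : Fin S.r → ℤ) : ℤ := ∑ j, a j * S.c j k

lemma gram_az (k : Fin S.r) (a : Fin S.r → ℤ) :
    S.gram a (S.az k) = S.prk k a * (S.len2 k : ℤ) := by
  rw [gram_apply, prk, Finset.sum_mul]
  refine Finset.sum_congr rfl fun i _ => ?_
  rw [Finset.sum_eq_single k]
  · simp [az]; ring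
  · intro j _ hj; simp [az, hj]
  · simp

lemma prk_az (k : Fin S.r) : S.prk k (S.az k) = 2 := by
  rw [prk, Finset.sum_eq_single k]
  · simp [az, S.hcdiag]
  · intro j _ hj; simp [az, hj]
  · simp

/-- simple reflection on the lattice. -/
def sz (k : Fin S.r) (a : Fin S.r → ℤ) : Fin S.r → ℤ := a - S.prk k a • S.az k

lemma sz_same (k : Fin S.r) (a : Fin S.r → ℤ) : S.sz k a k = a k - S.prk k a := by
  simp [sz, az]

lemma sz_other (k : Fin S.r) (a : Fin S.r → ℤ) (i : Fin S.r) (h : i ≠ k) :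
    S.sz k a i = a i := by
  simp [sz, az, h]

lemma coeV_sz (k : Fin S.r) (a : Fin S.r → ℤ) :
    S.coeV (S.sz k a) = S.sigma k (S.coeV a) := by
  funext i
  change ((S.sz k a i : ℤ) : ℝ) = (a i : ℝ) - (if i = k then ∑ j, (a j : ℝ) * (S.c j k : ℝ) else 0)
  by_cases h : i = k
  · subst h
    rw [sz_same]
    simp [prk]
  · rw [sz_other _ _ _ _ h]
    simp [h]

lemma coeV_inj : Function.Injective S.coeV := by
  intro a b h
  funext i
  have := congrFun h i
  simpa [coeV] using this

lemma sz_invol (k : Fin S.r) : Function.Involutive (S.sz k) := by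
  intro a
  apply S.coeV_inj
  rw [coeV_sz, coeV_sz]
  exact S.sMap_invol k _

lemma gram_sz (k : Fin S.r) (a : Fin S.r → ℤ) :
    S.gram (S.sz k a) (S.sz k a) = S.gram a a := by
  have h1 := S.gram_az k a
  have h2 := S.gram_symm (S.az k) a
  have h3 := S.gram_az k (S.az k)
  rw [prk_az] at h3
  simp only [sz, map_sub, map_smul, LinearMap.sub_apply, LinearMap.smul_apply, smul_eq_mul]
  rw [h2, h1, h3]
  ring

/-- the sublattice on which the form is divisible by `L`. -/
def MemL (L : ℤ) (a : Fin S.r → ℤ) : Prop := ∀ j, L ∣ a j * (S.len2 j : ℤ)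

lemma memL_sz (L : ℤ) (k : Fin S.r) (a : Fin S.r → ℤ) (h : S.MemL L a) :
    S.MemL L (S.sz k a) := by
  intro i
  by_cases hi : i = k
  · subst hi
    rw [sz_same, sub_mul]
    refine dvd_sub (h i) ?_
    rw [prk, Finset.sum_mul]
    refine Finset.dvd_sum fun j _ => ?_
    rw [mul_assoc, S.hsym j i, mul_left_comm]
    exact Dvd.dvd.mul_left (h j) _
  · rw [sz_other _ _ _ _ hi]
    exact h i

lemma gram_pos (a : Fin S.r → ℤ) (h : a ≠ 0) : 0 < S.gram a a := by
  have := S.hposdef (S.coeV a) (by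
    intro h0
    apply h
    apply S.coeV_inj
    rw [h0]
    funext i
    simp [coeV])
  rw [gram_apply]
  simp only [coeV] at this
  exact_mod_cast this

lemma even_sum {r : ℕ} (g : Fin r → Fin r → ℤ) (hs : ∀ i j, g i j = g j i)
    (hd : ∀ i, (2 : ℤ) ∣ g i i) : (2 : ℤ) ∣ ∑ i, ∑ j, g i j := by
  have h2 : ((∑ i, ∑ j, g i j : ℤ) : ZMod 2) = 0 := by
    push_cast
    rw [← Finset.sum_product']
    refine Finset.sum_involution (fun x _ => (x.2, x.1)) ?_ ?_ ?_ ?_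
    · intro x _
      simp only
      rw [hs x.2 x.1]
      exact CharTwo.add_self_eq_zero _
    · intro x _ hx heq
      apply hx
      have h1 : x.2 = x.1 := congrArg Prod.fst heq
      rw [h1]
      exact (ZMod.intCast_zmod_eq_zero_iff_dvd _ 2).2 (by exact_mod_cast hd x.1)
    · intro x _; simp
    · intro x _; rfl
  exact_mod_cast (ZMod.intCast_zmod_eq_zero_iff_dvd _ 2).1 h2

lemma gram_dvd (L : ℤ) (a : Fin S.r → ℤ) (h : S.MemL L a) : 2 * L ∣ S.gram a a := by
  choose b hb using h
  have hs : ∀ i j, a i * b j * S.c i j = a j * b i * S.c j i ∨ L = 0 := by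
    intro i j
    by_cases hL : L = 0
    · right; exact hL
    left
    apply mul_left_cancel₀ hL
    have h1 := hb i
    have h2 := hb j
    have h3 := S.hsym i j
    linear_combination (-(a i) * S.c i j) * h2 + (a j * S.c j i) * h1 + a i * a j * h3
  by_cases hL : L = 0
  · have : S.gram a a = 0 := by
      rw [gram_apply]
      refine Finset.sum_eq_zero fun i _ => Finset.sum_eq_zero fun j _ => ?_
      have h2 := hb j
      rw [hL] at h2
      linear_combination (a i * S.c i j) * h2
    rw [this]; exact dvd_zero _
  have e := even_sum (fun i j => a i * b j * S.c i j)
    (fun i j => (hs i j).resolve_right hL) (fun i => by simp [S.hcdiag])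
  have : S.gram a a = L * ∑ i, ∑ j, a i * b j * S.c i j := by
    rw [gram_apply, Finset.mul_sum]
    refine Finset.sum_congr rfl fun i _ => ?_
    rw [Finset.mul_sum]
    refine Finset.sum_congr rfl fun j _ => ?_
    linear_combination (a i * S.c i j) * hb j
  rw [this, mul_comm 2 L]
  exact mul_dvd_mul_left L e

/-- the sign dichotomy. -/
lemma sign_dich (L : ℤ) (hL : 0 < L) (a : Fin S.r → ℤ) (h : S.MemL L a)
    (hq : S.gram a a = 2 * L) : (∀ i, 0 ≤ a i) ∨ (∀ i, a i ≤ 0) := by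
  by_contra hcon
  push Not at hcon
  obtain ⟨⟨i, hi⟩, ⟨j, hj⟩⟩ := hcon
  let u : Fin S.r → ℤ := fun i => max (a i) 0
  let w : Fin S.r → ℤ := fun i => max (-(a i)) 0
  have hau : a = u - w := by
    funext i
    simp only [u, w, Pi.sub_apply]
    omega
  have hu0 : u ≠ 0 := by
    intro h0
    have := congrFun h0 j
    simp only [u, Pi.zero_apply] at this
    omega
  have hw0 : w ≠ 0 := by
    intro h0
    have := congrFun h0 i
    simp only [w, Pi.zero_apply] at this
    omega
  have huM : S.MemL L u := by
    intro i
    by_cases h0 : 0 ≤ a i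
    · have : u i = a i := max_eq_left h0
      rw [this]; exact h i
    · have : u i = 0 := max_eq_right (by omega)
      rw [this]; simp
  have hwM : S.MemL L w := by
    intro i
    by_cases h0 : 0 ≤ a i
    · have : w i = 0 := max_eq_right (by omega)
      rw [this]; simp
    · have : w i = -(a i) := max_eq_left (by omega)
      rw [this, neg_mul]; exact (h i).neg_right
  have h1 := Int.le_of_dvd (S.gram_pos u hu0) (S.gram_dvd L u huM)
  have h2 := Int.le_of_dvd (S.gram_pos w hw0) (S.gram_dvd L w hwM)
  have h3 : S.gram u w ≤ 0 := by
    rw [gram_apply]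
    refine Finset.sum_nonpos fun i _ => Finset.sum_nonpos fun j _ => ?_
    have hui : 0 ≤ u i := le_max_right _ _
    have hwj : 0 ≤ w j := le_max_right _ _
    by_cases hij : i = j
    · subst hij
      have : u i * w i = 0 := by
        by_cases h0 : 0 ≤ a i
        · have : w i = 0 := max_eq_right (by omega)
          rw [this, mul_zero]
        · have : u i = 0 := max_eq_right (by omega)
          rw [this, zero_mul]
      rw [this, zero_mul]
    · exact mul_nonpos_of_nonneg_of_nonpos (mul_nonneg hui hwj)
        (mul_nonpos_of_nonpos_of_nonneg (S.hcoff i j hij) (by positivity))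
  have h4 := S.gram_symm w u
  rw [hau] at hq
  simp only [map_sub, LinearMap.sub_apply] at hq
  linarith

/-- Weyl group elements act on the lattice, preserving the form and the sublattices. -/
lemma weyl_lattice (w : (Fin S.r → ℝ) ≃ₗ[ℝ] (Fin S.r → ℝ)) (hw : w ∈ S.Wgrp) :
    ∃ e : (Fin S.r → ℤ) ≃ (Fin S.r → ℤ), ∀ a, S.coeV (e a) = w (S.coeV a) ∧
      S.gram (e a) (e a) = S.gram a a ∧ ∀ L, S.MemL L (e a) ↔ S.MemL L a := by
  unfold Wgrp at hw
  induction hw using Subgroup.closure_induction with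
  | mem x hx =>
    obtain ⟨k, rfl⟩ := hx
    refine ⟨(S.sz_invol k).toPerm, fun a => ⟨S.coeV_sz k a, S.gram_sz k a, fun L => ⟨fun h => ?_, fun h => S.memL_sz L k a h⟩⟩⟩
    have := S.memL_sz L k _ h
    rwa [Function.Involutive.coe_toPerm, S.sz_invol k a] at this
  | one => exact ⟨Equiv.refl _, fun a => ⟨rfl, rfl, fun L => Iff.rfl⟩⟩
  | mul x y _ _ hx hy =>
    obtain ⟨e, he⟩ := hx
    obtain ⟨f, hf⟩ := hy
    refine ⟨f.trans e, fun a => ⟨?_, ?_, fun L => ?_⟩⟩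
    · simp only [Equiv.trans_apply]
      rw [(he _).1, (hf _).1]; rfl
    · simp only [Equiv.trans_apply]
      rw [(he _).2.1, (hf _).2.1]
    · simp only [Equiv.trans_apply]
      rw [(he _).2.2, (hf _).2.2]
  | inv x _ hx =>
    obtain ⟨e, he⟩ := hx
    refine ⟨e.symm, fun a => ?_⟩
    obtain ⟨h1, h2, h3⟩ := he (e.symm a)
    rw [Equiv.apply_symm_apply] at h1 h2 h3
    refine ⟨?_, h2.symm, fun L => (h3 L).symm⟩
    rw [h1]
    exact (x.symm_apply_apply _).symm

lemma coeV_az (i : Fin S.r) : S.coeV (S.az i) = S.av i := by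
  funext j
  by_cases h : j = i
  · subst h; simp [coeV, az, av]
  · simp [coeV, az, av, h]

lemma rootLen2_eq (a : Fin S.r → ℤ) : S.rootLen2 a = S.gram a a / 2 := by
  rw [gram_apply]; rfl

lemma nroot_sz (k : Fin S.r) (a : Fin S.r → ℤ) : S.nroot (S.sz k a) = S.nroot a := by
  rw [nroot, nroot, rootLen2_eq, rootLen2_eq, gram_sz]

lemma nroot_az (k : Fin S.r) : S.nroot (S.az k) = S.nk k := by
  rw [nroot, nk, rootLen2_eq, gram_az, prk_az]
  simp

lemma nroot_pos (a : Fin S.r → ℤ) : 0 < S.nroot a :=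
  Nat.div_pos (Nat.le_of_dvd S.hn (Nat.gcd_dvd_left _ _)) (Nat.gcd_pos_of_pos_left _ S.hn)

lemma ht_sz (k : Fin S.r) (a : Fin S.r → ℤ) : S.ht (S.sz k a) = S.ht a - S.prk k a := by
  simp [ht, sz, az, Finset.sum_sub_distrib, ← Finset.mul_sum]

lemma Xk_ne (i : Fin S.r) : S.Xk i ≠ 0 := by
  unfold Xk
  rw [Ne, IsFractionRing.to_map_eq_zero_iff]
  exact MvPolynomial.X_ne_zero i

lemma p_ne : (S.p : ℂ) ≠ 0 := by
  have := S.hp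
  exact_mod_cast (by linarith : S.p ≠ 0)

lemma cst_ne (z : ℂ) (h : z ≠ 0) : S.cst z ≠ 0 := by
  unfold cst
  rw [Ne, IsFractionRing.to_map_eq_zero_iff]
  simpa using h

lemma pK_ne : S.pK ≠ 0 := S.cst_ne _ S.p_ne

lemma mono_ne (a : Fin S.r → ℤ) : S.mono a ≠ 0 :=
  Finset.prod_ne_zero_iff.2 fun i _ => zpow_ne_zero _ (S.Xk_ne i)

lemma prod_zpow_sum {F ι : Type*} [Field F] (s : Finset ι) (x : F) (hx : x ≠ 0) (f : ι → ℤ) :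
    ∏ i ∈ s, x ^ f i = x ^ (∑ i ∈ s, f i) := by
  classical
  induction s using Finset.induction_on with
  | empty => simp
  | insert a s ha ih => rw [Finset.prod_insert ha, Finset.sum_insert ha, ih, zpow_add₀ hx]

lemma mono_add (a b : Fin S.r → ℤ) : S.mono (a + b) = S.mono a * S.mono b := by
  unfold mono
  rw [← Finset.prod_mul_distrib]
  exact Finset.prod_congr rfl fun i _ => zpow_add₀ (S.Xk_ne i) _ _

lemma mono_smul (t : ℤ) (a : Fin S.r → ℤ) : S.mono (t • a) = S.mono a ^ t := by
  unfold mono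
  rw [← Finset.prod_zpow]
  refine Finset.prod_congr rfl fun i _ => ?_
  rw [← zpow_mul, Pi.smul_apply, smul_eq_mul, mul_comm]

lemma mono_az (k : Fin S.r) : S.mono (S.az k) = S.Xk k := by
  unfold mono
  rw [Finset.prod_eq_single k]
  · simp [az]
  · intro j _ hj; simp [az, hj]
  · simp

/-- the zpow of pK is a constant -/
lemma pK_zpow (e : ℤ) : S.pK ^ e = S.cst ((S.p : ℂ) ^ e) := by
  exact (map_zpow₀ ((algebraMap (MvPolynomial (Fin S.r) ℂ) S.K).comp MvPolynomial.C) (S.p : ℂ) e).symm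

lemma factor_ne (e : ℤ) (b : Fin S.r → ℤ) (hb : ∀ i, 0 ≤ b i) (hb0 : ∃ i, 0 < b i) :
    1 - S.pK ^ e * S.mono b ≠ 0 := by
  intro h
  obtain ⟨i, hi⟩ := hb0
  have h1 : S.pK ^ e * S.mono b = algebraMap (MvPolynomial (Fin S.r) ℂ) S.K
      (MvPolynomial.C ((S.p : ℂ) ^ e) * ∏ i, MvPolynomial.X i ^ (b i).toNat) := by
    rw [pK_zpow, map_mul, map_prod]
    congr 1
    refine Finset.prod_congr rfl fun i _ => ?_
    rw [map_pow]
    conv_lhs => rw [← Int.toNat_of_nonneg (hb i), zpow_natCast]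
    rfl
  have h2 : algebraMap (MvPolynomial (Fin S.r) ℂ) S.K
      (MvPolynomial.C ((S.p : ℂ) ^ e) * ∏ i, MvPolynomial.X i ^ (b i).toNat) =
      algebraMap (MvPolynomial (Fin S.r) ℂ) S.K 1 := by
    rw [← h1, map_one]
    exact (sub_eq_zero.1 h).symm
  have h3 := IsFractionRing.injective (MvPolynomial (Fin S.r) ℂ) S.K h2
  have h4 := congrArg (MvPolynomial.eval (fun _ => (0 : ℂ))) h3
  rw [map_mul, map_prod, Finset.prod_eq_zero (Finset.mem_univ i)] at h4
  · simp at h4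
  · rw [map_pow, MvPolynomial.eval_X]
    exact zero_pow (by omega)

end Setup

namespace Data

variable (D : Data)

lemma phi_prop (a : Fin D.r → ℤ) (ha : a ∈ D.Phi) :
    ∃ L : ℤ, 0 < L ∧ D.toSetup.MemL L a ∧ D.toSetup.gram a a = 2 * L := by
  obtain ⟨w, hw, i, hi⟩ := (D.hPhi a).1 ha
  obtain ⟨e, he⟩ := D.toSetup.weyl_lattice w hw
  obtain ⟨h1, h2, h3⟩ := he (D.toSetup.az i)
  rw [D.toSetup.coeV_az, ← hi] at h1
  have h4 := D.toSetup.coeV_inj h1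
  rw [h4] at h2 h3
  refine ⟨(D.len2 i : ℤ), by exact_mod_cast D.hlen2 i, (h3 _).2 ?_, ?_⟩
  · intro j
    by_cases hj : j = i
    · subst hj; exact Dvd.intro_left _ rfl
    · simp [Setup.az, hj]
  · rw [h2, D.toSetup.gram_az, D.toSetup.prk_az]

lemma phi_sz (k : Fin D.r) (a : Fin D.r → ℤ) (ha : a ∈ D.Phi) : D.toSetup.sz k a ∈ D.Phi := by
  obtain ⟨w, hw, i, hi⟩ := (D.hPhi a).1 ha
  refine (D.hPhi _).2 ⟨D.toSetup.sigma k * w,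
    mul_mem (Subgroup.subset_closure ⟨k, rfl⟩) hw, i, ?_⟩
  rw [D.toSetup.coeV_sz, hi]
  rfl

lemma az_mem (k : Fin D.r) : D.toSetup.az k ∈ D.PhiPos := by
  refine Finset.mem_filter.2 ⟨(D.hPhi _).2 ⟨1, one_mem _, k, ?_⟩, fun i => ?_⟩
  · rw [D.toSetup.coeV_az]; rfl
  · by_cases h : i = k
    · subst h; simp [Setup.az]
    · simp [Setup.az, h]

lemma exists_pos (a : Fin D.r → ℤ) (ha : a ∈ D.PhiPos) : ∃ i, 0 < a i := by
  obtain ⟨h1, h2⟩ := Finset.mem_filter.1 ha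
  obtain ⟨L, hL, _, hq⟩ := D.phi_prop a h1
  by_contra hcon
  push Not at hcon
  have : a = 0 := funext fun i => le_antisymm (hcon i) (h2 i)
  rw [this] at hq
  simp at hq
  omega

lemma exists_other (k : Fin D.r) (a : Fin D.r → ℤ) (ha : a ∈ D.PhiPos)
    (hne : a ≠ D.toSetup.az k) : ∃ i, i ≠ k ∧ 0 < a i := by
  obtain ⟨h1, h2⟩ := Finset.mem_filter.1 ha
  obtain ⟨L, hL, hM, hq⟩ := D.phi_prop a h1
  by_contra hcon
  push Not at hcon
  have hak : a = a k • D.toSetup.az k := by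
    funext i
    by_cases h : i = k
    · subst h; simp [Setup.az]
    · have := le_antisymm (hcon i h) (h2 i)
      simp [Setup.az, h, this]
  have hq' : a k * (a k * (D.len2 k : ℤ)) = L := by
    rw [hak] at hq
    simp only [map_smul, LinearMap.smul_apply, smul_eq_mul] at hq
    rw [D.toSetup.gram_az, D.toSetup.prk_az] at hq
    linarith
  obtain ⟨s, hs⟩ := hM k
  rw [hs] at hq'
  have h3 : a k * s = 1 := by
    apply mul_left_cancel₀ hL.ne'
    linarith
  have h4 : a k = 1 := Int.eq_one_of_mul_eq_one_right (h2 k) h3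
  apply hne
  rw [hak, h4, one_smul]

lemma sz_mem (k : Fin D.r) (a : Fin D.r → ℤ) (ha : a ∈ D.PhiPos.erase (D.toSetup.az k)) :
    D.toSetup.sz k a ∈ D.PhiPos.erase (D.toSetup.az k) := by
  obtain ⟨hne, ha⟩ := Finset.mem_erase.1 ha
  obtain ⟨i, hik, hi⟩ := D.exists_other k a ha hne
  have h1 := D.phi_sz k a (Finset.mem_filter.1 ha).1
  obtain ⟨L, hL, hM, hq⟩ := D.phi_prop _ h1
  have h2 := D.toSetup.sz_other k a i hik
  refine Finset.mem_erase.2 ⟨?_, Finset.mem_filter.2 ⟨h1, ?_⟩⟩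
  · intro h
    rw [h] at h2
    simp [Setup.az, hik] at h2
    omega
  · rcases D.toSetup.sign_dich L hL _ hM hq with h | h
    · exact h
    · have := h i
      omega

/-- the factor of `D(x)` at `a`. -/
def fac (a : Fin D.r → ℤ) : D.toSetup.K :=
  1 - D.toSetup.pK ^ ((D.toSetup.nroot a : ℤ) * D.toSetup.ht a - 1) *
      D.toSetup.mono ((D.toSetup.nroot a : ℤ) • a)

lemma fac_ne (a : Fin D.r → ℤ) (ha : a ∈ D.PhiPos) : D.fac a ≠ 0 := by
  have hn : (0 : ℤ) < D.toSetup.nroot a := by exact_mod_cast D.toSetup.nroot_pos a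
  apply D.toSetup.factor_ne
  · intro i
    exact mul_nonneg hn.le ((Finset.mem_filter.1 ha).2 i)
  · obtain ⟨i, hi⟩ := D.exists_pos a ha
    exact ⟨i, mul_pos hn hi⟩

lemma Dfun_split (k : Fin D.r) :
    D.Dfun = D.fac (D.toSetup.az k) * ∏ a ∈ D.PhiPos.erase (D.toSetup.az k), D.fac a :=
  (Finset.mul_prod_erase _ _ (D.az_mem k)).symm

end Data

namespace CG

variable (C : CG)

lemma cov_pK (k : Fin C.r) : C.covW (C.toSetup.sigma k) C.toSetup.pK = C.toSetup.pK :=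
  C.hcovW_cst _ _

lemma cov_mono (k : Fin C.r) (a : Fin C.r → ℤ) :
    C.covW (C.toSetup.sigma k) (C.toSetup.mono a) =
      C.toSetup.pK ^ (-(C.toSetup.prk k a)) * C.toSetup.mono (C.toSetup.sz k a) := by
  have h1 : C.toSetup.mono (C.toSetup.sz k a) =
      C.toSetup.mono a * C.toSetup.Xk k ^ (-(C.toSetup.prk k a)) := by
    rw [Setup.sz, sub_eq_add_neg, ← neg_smul, Setup.mono_add, Setup.mono_smul, Setup.mono_az]
  have hs : -(C.toSetup.prk k a) = ∑ i, (-(C.c i k)) * a i := by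
    rw [Setup.prk, ← Finset.sum_neg_distrib]
    exact Finset.sum_congr rfl fun i _ => by ring
  rw [h1, hs, ← Setup.prod_zpow_sum _ _ C.toSetup.pK_ne, ← Setup.prod_zpow_sum _ _ (C.toSetup.Xk_ne k)]
  unfold Setup.mono
  rw [map_prod, ← Finset.prod_mul_distrib, ← Finset.prod_mul_distrib]
  refine Finset.prod_congr rfl fun i _ => ?_
  rw [map_zpow₀, C.hcovW_gen, mul_zpow, mul_zpow, ← zpow_mul, ← zpow_mul, mul_assoc]

lemma cov_fac (k : Fin C.r) (a : Fin C.r → ℤ) :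
    C.covW (C.toSetup.sigma k) (C.toData.fac a) = C.toData.fac (C.toSetup.sz k a) := by
  unfold Data.fac
  rw [map_sub, map_one, map_mul, map_zpow₀, cov_pK, Setup.mono_smul, map_zpow₀, cov_mono,
    Setup.nroot_sz, Setup.ht_sz, Setup.mono_smul, mul_zpow, ← mul_assoc, ← zpow_mul,
    ← zpow_add₀ C.toSetup.pK_ne]
  congr 3
  ring_nf

lemma cov_rest (k : Fin C.r) :
    C.covW (C.toSetup.sigma k) (∏ a ∈ C.PhiPos.erase (C.toSetup.az k), C.toData.fac a) =
      ∏ a ∈ C.PhiPos.erase (C.toSetup.az k), C.toData.fac a := by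
  rw [map_prod]
  refine Finset.prod_bij (fun a _ => C.toSetup.sz k a) (fun a ha => C.toData.sz_mem k a ha)
    (fun a _ b _ h => (C.toSetup.sz_invol k).injective h)
    (fun b hb => ⟨C.toSetup.sz k b, C.toData.sz_mem k b hb, C.toSetup.sz_invol k b⟩)
    (fun a _ => C.cov_fac k a)

end CG

end CGMDS

open CGMDS in
/-- **Equation (3.4): the factor `D(x)/D(σ_k x)`.** For a simple reflection
`σ = σ_k`, with `α = α_k` and `m = n(α_k)`,
`D(x)/D(σx) = |p|^{m+1} x^{mα}(1 − |p|^{m−1}x^{mα}) / (|p|^{m+1}x^{mα} − 1)`. -/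
theorem statement_12 (C : CG) (k : Fin C.r) :
    C.toData.Dfun / C.covW (C.toSetup.sigma k) C.toData.Dfun =
      C.toSetup.pK ^ ((C.toSetup.nk k : ℤ) + 1) *
          C.toSetup.mono ((C.toSetup.nk k : ℤ) • C.toSetup.az k) *
          (1 - C.toSetup.pK ^ ((C.toSetup.nk k : ℤ) - 1) *
            C.toSetup.mono ((C.toSetup.nk k : ℤ) • C.toSetup.az k)) /
        (C.toSetup.pK ^ ((C.toSetup.nk k : ℤ) + 1) *
            C.toSetup.mono ((C.toSetup.nk k : ℤ) • C.toSetup.az k) - 1) := by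
  rw [C.toData.Dfun_split k, map_mul, C.cov_rest k, C.cov_fac]
  have hE : ∏ a ∈ C.PhiPos.erase (C.toSetup.az k), C.toData.fac a ≠ 0 :=
    Finset.prod_ne_zero_iff.2 fun a ha => C.toData.fac_ne a (Finset.mem_of_mem_erase ha)
  rw [mul_div_mul_right _ _ hE]
  have hsz : C.toSetup.sz k (C.toSetup.az k) = -C.toSetup.az k := by
    rw [Setup.sz, Setup.prk_az, two_smul]
    abel
  have hht : C.toSetup.ht (C.toSetup.az k) = 1 := by
    simp [Setup.ht, Setup.az]
  have hp := C.toSetup.pK_ne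
  have hx := C.toSetup.Xk_ne k
  have e1 : C.toData.fac (C.toSetup.az k) = 1 - C.toSetup.pK ^ ((C.toSetup.nk k : ℤ) - 1) *
      C.toSetup.mono ((C.toSetup.nk k : ℤ) • C.toSetup.az k) := by
    rw [Data.fac, Setup.nroot_az, hht, mul_one]
  have e2 : C.toData.fac (C.toSetup.sz k (C.toSetup.az k)) =
      1 - (C.toSetup.pK ^ ((C.toSetup.nk k : ℤ) + 1) *
        C.toSetup.mono ((C.toSetup.nk k : ℤ) • C.toSetup.az k))⁻¹ := by
    rw [Data.fac, Setup.nroot_sz, Setup.nroot_az, Setup.ht_sz, hht, Setup.prk_az, hsz, smul_neg,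
      ← neg_smul, Setup.mono_smul, Setup.mono_smul, mul_inv, ← zpow_neg, ← zpow_neg]
    congr 3
    ring
  rw [e1, e2]
  have hv : C.toSetup.pK ^ ((C.toSetup.nk k : ℤ) + 1) *
        C.toSetup.mono ((C.toSetup.nk k : ℤ) • C.toSetup.az k) ≠ 0 :=
    mul_ne_zero (zpow_ne_zero _ hp) (C.toSetup.mono_ne _)
  generalize C.toSetup.pK ^ ((C.toSetup.nk k : ℤ) + 1) *
        C.toSetup.mono ((C.toSetup.nk k : ℤ) • C.toSetup.az k) = v at hv ⊢
  have e3 : v - 1 = v * (1 - v⁻¹) := by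
    rw [mul_sub, mul_inv_cancel₀ hv, mul_one]
  rw [e3, mul_div_mul_left _ _ hv]
end
end

section
/- Fix a simple reflection σ = σ_k, α = α_k, m = n(α_k), and λ ∈ Λ with δ = δ_k(λ) satisfying (δ)_m ≠ 0, and set μ = σ_k•λ and ν = m − (δ)_m. Then: (i) for γ = λ − να, 1 − δ + δ_k(γ) − (δ_k(γ))_m = 1 + m − (δ)_m; and (ii) for γ = μ + να, m + δ_k(γ) − (δ_k(γ))_m = (δ)_m − δ − m. -/
open scoped BigOperators

noncomputable section

/-- translating by a multiple of `α_k` shifts `δ_k` by twice that multiple. -/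
theorem CGMDS.Setup.delta_add_single (S : CGMDS.Setup) (Lt : Fin S.r → ℕ) (k : Fin S.r)
    (lam : Fin S.r → ℤ) (t : ℤ) :
    S.delta Lt k (fun i => lam i + (if i = k then t else 0)) = S.delta Lt k lam - 2 * t := by
  unfold CGMDS.Setup.delta
  simp only [add_mul, Finset.sum_add_distrib, ite_mul, zero_mul, Finset.sum_ite_eq',
    Finset.mem_univ, if_true, S.hcdiag k]
  ring

theorem CGMDS.Setup.delta_add_az (S : CGMDS.Setup) (Lt : Fin S.r → ℕ) (k : Fin S.r)
    (lam : Fin S.r → ℤ) (t : ℤ) :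
    S.delta Lt k (lam + t • S.az k) = S.delta Lt k lam - 2 * t := by
  rw [← S.delta_add_single]
  congr 1
  funext i
  simp [CGMDS.Setup.az, Pi.single_apply]

open CGMDS in
/-- **(Exponent simplifications in the proof of Theorem 3.1.)** Fix `σ = σ_k`,
`α = α_k`, `m = n(α_k)`, and `λ ∈ Λ` with `δ = δ_k(λ)`, `(δ)_m ≠ 0`, `μ = σ_k•λ`
and `ν = m − (δ)_m`.  Then:
(i) for `γ = λ − να`, `1 − δ + δ_k(γ) − (δ_k(γ))_m = 1 + m − (δ)_m`; and
(ii) for `γ = μ + να`, `m + δ_k(γ) − (δ_k(γ))_m = (δ)_m − δ − m`. -/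
theorem statement_14 (S : Setup) (ℓ : Fin S.r → ℕ) (k : Fin S.r) (lam : Fin S.r → ℤ)
    (h : S.delta ℓ k lam % (S.nk k : ℤ) ≠ 0) :
    (1 - S.delta ℓ k lam
        + S.delta ℓ k (lam - ((S.nk k : ℤ) - S.delta ℓ k lam % (S.nk k : ℤ)) • S.az k)
        - S.delta ℓ k (lam - ((S.nk k : ℤ) - S.delta ℓ k lam % (S.nk k : ℤ)) • S.az k) %
            (S.nk k : ℤ)
      = 1 + (S.nk k : ℤ) - S.delta ℓ k lam % (S.nk k : ℤ)) ∧
    ((S.nk k : ℤ)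
        + S.delta ℓ k (S.bull ℓ k lam +
            ((S.nk k : ℤ) - S.delta ℓ k lam % (S.nk k : ℤ)) • S.az k)
        - S.delta ℓ k (S.bull ℓ k lam +
            ((S.nk k : ℤ) - S.delta ℓ k lam % (S.nk k : ℤ)) • S.az k) % (S.nk k : ℤ)
      = S.delta ℓ k lam % (S.nk k : ℤ) - S.delta ℓ k lam - (S.nk k : ℤ)) := by
  have hm : (0 : ℤ) < (S.nk k : ℤ) := by
    have : 0 < S.nk k :=
      Nat.div_pos (Nat.le_of_dvd S.hn (Nat.gcd_dvd_left _ _)) (Nat.gcd_pos_of_pos_left _ S.hn)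
    exact_mod_cast this
  have hbull : S.delta ℓ k (S.bull ℓ k lam) = - S.delta ℓ k lam := by
    unfold Setup.bull
    rw [S.delta_add_single]
    ring
  rw [sub_eq_add_neg lam, ← neg_smul, S.delta_add_az, S.delta_add_az, hbull]
  generalize S.delta ℓ k lam = d at *
  generalize (S.nk k : ℤ) = m at *
  have h0 : 0 ≤ d % m := Int.emod_nonneg _ hm.ne'
  have h1 : d % m < m := Int.emod_lt_of_pos _ hm
  have hd : d = m * (d / m) + d % m := (Int.mul_ediv_add_emod d m).symm
  generalize d % m = r at *
  generalize d / m = q at *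
  have e1 : (d - 2 * -(m - r)) % m = m - r := by
    have : d - 2 * -(m - r) = (m - r) + m * (q + 1) := by rw [hd]; ring
    rw [this, Int.add_mul_emod_self_left]
    exact Int.emod_eq_of_lt (by omega) (by omega)
  have e2 : (-d - 2 * (m - r)) % m = r := by
    have : -d - 2 * (m - r) = r + m * (-q - 2) := by rw [hd]; ring
    rw [this, Int.add_mul_emod_self_left]
    exact Int.emod_eq_of_lt (by omega) (by omega)
  rw [e1, e2]
  constructor <;> ring
end
end

section
/- Let w ∈ W, σ_j a simple reflection, λ = θ − w^{-1}θ, and write μ = σ_j•λ = θ − σ_j w^{-1}θ = Σ_i k_i α_i. Then δ_j(λ) = d(μ − λ) = ⟨θ, wα_j⟩ = Σ_i k_i c_{ij} − l_j − 1. In particular, the quantity δ_j(λ) from the Chinta–Gunnells recurrence equals the pairing d_θ(wα_j) := ⟨θ, wα_j⟩ appearing in the Brubaker–Bump–Friedberg stable coefficients. -/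
open scoped BigOperators

noncomputable section

namespace CGMDS.Setup

variable (S : Setup)

lemma aux_B_add_left (v v' u : Fin S.r → ℝ) : S.B (v + v') u = S.B v u + S.B v' u := by
  simp only [B, Pi.add_apply, add_mul, Finset.sum_add_distrib, add_div]

lemma aux_B_smul_left (t : ℝ) (v u : Fin S.r → ℝ) : S.B (t • v) u = t * S.B v u := by
  simp only [B, Pi.smul_apply, smul_eq_mul, mul_assoc, ← Finset.mul_sum, mul_div_assoc]

lemma aux_B_symm (v u : Fin S.r → ℝ) : S.B v u = S.B u v := by
  unfold B
  congr 1
  rw [Finset.sum_comm]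
  refine Finset.sum_congr rfl fun i _ => Finset.sum_congr rfl fun k _ => ?_
  rw [S.hsym k i]
  ring

lemma aux_B_av (v : Fin S.r → ℝ) (k : Fin S.r) :
    S.B v (S.av k) = (∑ m, v m * (S.c m k : ℝ)) * (S.len2 k : ℝ) / 2 := by
  unfold B av
  congr 1
  rw [Finset.sum_mul]
  refine Finset.sum_congr rfl fun i _ => ?_
  rw [Finset.sum_eq_single k]
  · simp
    ring
  · intro b _ hb
    simp [Pi.single_apply, hb]
  · simp

lemma aux_B_av_av (k : Fin S.r) : S.B (S.av k) (S.av k) = (S.len2 k : ℝ) := by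
  rw [aux_B_av, Finset.sum_eq_single k]
  · simp [av, S.hcdiag]
  · intro b _ hb
    simp [av, Pi.single_apply, hb]
  · simp

lemma aux_sigma (k : Fin S.r) (v : Fin S.r → ℝ) :
    S.sigma k v = v + (-(∑ m, v m * (S.c m k : ℝ))) • S.av k := by
  funext i
  change v i - (if i = k then ∑ j, v j * (S.c j k : ℝ) else 0) = _
  by_cases h : i = k
  · subst h
    simp [av, sub_eq_add_neg]
  · simp [av, Pi.single_apply, h]

lemma aux_B_sigma (k : Fin S.r) (v u : Fin S.r → ℝ) :
    S.B (S.sigma k v) (S.sigma k u) = S.B v u := by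
  rw [aux_sigma, aux_sigma]
  rw [aux_B_add_left, aux_B_smul_left, aux_B_symm S v, aux_B_symm S (S.av k),
    aux_B_add_left, aux_B_smul_left, aux_B_add_left, aux_B_smul_left, aux_B_av_av,
    aux_B_symm S (S.av k) v, aux_B_av, aux_B_av, aux_B_symm S u v]
  ring

lemma aux_B_W (w : (Fin S.r → ℝ) ≃ₗ[ℝ] (Fin S.r → ℝ)) (hw : w ∈ S.Wgrp) :
    ∀ v u, S.B (w v) (w u) = S.B v u := by
  unfold Wgrp at hw
  induction hw using Subgroup.closure_induction with
  | mem x hx =>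
    obtain ⟨k, rfl⟩ := hx
    exact S.aux_B_sigma k
  | one => intro v u; rfl
  | mul x y _ _ hx hy =>
    intro v u
    rw [LinearEquiv.mul_apply, LinearEquiv.mul_apply, hx, hy]
  | inv x _ hx =>
    intro v u
    rw [← hx]
    rw [← LinearEquiv.mul_apply, ← LinearEquiv.mul_apply, mul_inv_cancel]
    rfl

end CGMDS.Setup

lemma CGMDS.Data.aux_theta (D : CGMDS.Data) (L : Fin D.r → ℕ) (j : Fin D.r) :
    ∑ m, D.θv L m * (D.c m j : ℝ) = (L j : ℝ) + 1 := by
  unfold CGMDS.Data.θv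
  simp only [Finset.sum_apply, Pi.smul_apply, smul_eq_mul, Finset.sum_mul]
  rw [Finset.sum_comm]
  simp only [mul_assoc, ← Finset.mul_sum, D.hwt]
  simp

open CGMDS in
/-- **(Computation in the proof of Theorem 4.1.)** Let `w ∈ W`, `σ_j` a simple
reflection, `λ = θ − w⁻¹θ` and `μ = σ_j•λ = Σ_i k_i α_i`.  Then
`δ_j(λ) = d(μ − λ) = ⟨θ, wα_j⟩ = Σ_i k_i c_{ij} − l_j − 1`; in particular the
quantity `δ_j(λ)` of the Chinta–Gunnells recurrence equals the pairing
`d_θ(wα_j) = ⟨θ, wα_j⟩` of the Brubaker–Bump–Friedberg stable coefficients. -/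
theorem statement_15 (D : Data) (ℓ : Fin D.r → ℕ) (j : Fin D.r)
    (w : (Fin D.r → ℝ) ≃ₗ[ℝ] (Fin D.r → ℝ)) (hw : w ∈ D.toSetup.Wgrp)
    (lam mu : Fin D.r → ℤ)
    (hlam : D.toSetup.coeV lam = D.θv ℓ - w⁻¹ (D.θv ℓ))
    (hmu : mu = D.toSetup.bull ℓ j lam) :
    D.toSetup.delta ℓ j lam = D.toSetup.ht (mu - lam) ∧
    D.toSetup.delta ℓ j lam = (∑ i, mu i * D.toSetup.c i j) - ((ℓ j : ℤ) + 1) ∧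
    (D.toSetup.delta ℓ j lam : ℝ) =
      2 * D.toSetup.B (D.θv ℓ) (w (D.toSetup.av j)) /
        D.toSetup.B (w (D.toSetup.av j)) (w (D.toSetup.av j)) := by
  subst hmu
  refine ⟨?_, ?_, ?_⟩
  · simp [Setup.ht, Setup.bull]
  · simp only [Setup.bull, add_mul, Finset.sum_add_distrib, ite_mul, zero_mul,
      Finset.sum_ite_eq', Finset.mem_univ, if_true, D.hcdiag]
    unfold Setup.delta
    ring
  · have h1 : D.toSetup.B (D.θv ℓ) (w (D.toSetup.av j))
        = D.toSetup.B (w⁻¹ (D.θv ℓ)) (D.toSetup.av j) := by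
      rw [← D.toSetup.aux_B_W w hw (w⁻¹ (D.θv ℓ)), ← LinearEquiv.mul_apply, mul_inv_cancel]
      rfl
    have h2 : w⁻¹ (D.θv ℓ) = D.θv ℓ - D.toSetup.coeV lam := by
      rw [hlam]; abel
    have h3 : (D.toSetup.len2 j : ℝ) ≠ 0 := by
      exact_mod_cast (D.toSetup.hlen2 j).ne'
    rw [h1, D.toSetup.aux_B_W w hw, Setup.aux_B_av_av, Setup.aux_B_av, h2]
    simp only [Pi.sub_apply, sub_mul, Finset.sum_sub_distrib]
    rw [D.aux_theta]
    simp only [Setup.delta, Setup.coeV]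
    push_cast
    field_simp
end
end
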